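/- Let X₁, X₂ be Hilbert spaces, J : X₁ → X₂ a compact linear operator, and T a compact self-adjoint operator on X₂. Then for every s > 0 and every ε in (0,1), n_+(s; J*(I - T)J) ≥ n_+(s; (1-ε) J*J) - Tr 1_{[ε,∞)}(T). -/

import Mathlib

open scoped ENNReal

/-- Counting of eigenvalues (with multiplicity) of `T` lying in the real set `S`. -/
noncomputable def eigCount {H : Type*} [NormedAddCommGroup H] [InnerProductSpace ℂ H]
    (T : H →L[ℂ] H) (S : Set ℝ) : ℝ≥0∞ :=
  ∑' μ : S, (Module.finrank ℂ (Module.End.eigenspace (T : H →ₗ[ℂ] H) (μ : ℂ)) : ℝ≥0∞)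

open Module.End in
theorem cs_quad {H : Type*} [NormedAddCommGroup H] [InnerProductSpace ℂ H]
    (C : H →L[ℂ] H) (hC : (C : H →ₗ[ℂ] H).IsSymmetric) {ι : Type*} (m : ι → ℂ)
    (hm : Function.Injective m) (f : ∀ i, eigenspace (C : H →ₗ[ℂ] H) (m i)) (s : Finset ι) :
    (inner ℂ (C (∑ i ∈ s, (f i : H))) (∑ i ∈ s, (f i : H))).re = ∑ i ∈ s, (m i).re * ‖f i‖ ^ 2
    ∧ ‖∑ i ∈ s, (f i : H)‖ ^ 2 = ∑ i ∈ s, ‖f i‖ ^ 2 := by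
  have hV := hC.orthogonalFamily_eigenspaces.comp hm
  refine ⟨?_, hV.norm_sum f s⟩
  have h1 : C (∑ i ∈ s, (f i : H)) = ∑ i ∈ s, ((m i • f i : eigenspace (C : H →ₗ[ℂ] H) (m i)) : H) := by
    rw [map_sum]
    exact Finset.sum_congr rfl fun i _ => mem_eigenspace_iff.mp (f i).2
  rw [h1]
  have h2 := hV.inner_sum (fun i => m i • f i) f s
  simp only [Submodule.coe_subtypeₗᵢ, Submodule.subtype_apply] at h2
  rw [h2, Complex.re_sum]
  refine Finset.sum_congr rfl fun i _ => ?_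
  rw [inner_smul_left, inner_self_eq_norm_sq_to_K]
  simp [← Complex.ofReal_pow]

open Module.End in
theorem cs_upper {H : Type*} [NormedAddCommGroup H] [InnerProductSpace ℂ H] [CompleteSpace H]
    (C : H →L[ℂ] H) (hc : IsCompactOperator C) (hC : (C : H →ₗ[ℂ] H).IsSymmetric)
    (S : Set ℝ) (c : ℝ) (hS : ∀ μ, c < μ → μ ∈ S) (x : H)
    (hx : ∀ μ ∈ S, ∀ v ∈ eigenspace (C : H →ₗ[ℂ] H) (μ : ℂ), inner ℂ v x = 0) :
    (inner ℂ (C x) x).re ≤ c * ‖x‖ ^ 2 := by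
  classical
  let L : Submodule ℂ H := ⨆ μ : {μ : ℂ // μ.re ≤ c}, eigenspace (C : H →ₗ[ℂ] H) (μ : ℂ)
  have hclosed : IsClosed {y : H | (inner ℂ (C y) y).re ≤ c * ‖y‖ ^ 2} := by
    apply isClosed_le <;> fun_prop
  have hL : ∀ y ∈ L, (inner ℂ (C y) y).re ≤ c * ‖y‖ ^ 2 := by
    intro y hy
    obtain ⟨f, hf, rfl⟩ := (Submodule.mem_iSup_iff_exists_finsupp _ _).1 hy
    obtain ⟨h1, h2⟩ := cs_quad C hC (fun μ : {μ : ℂ // μ.re ≤ c} => (μ : ℂ))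
      Subtype.val_injective (fun i => ⟨f i, hf i⟩) f.support
    simp only [Finsupp.sum] at *
    rw [h1, h2, Finset.mul_sum]
    exact Finset.sum_le_sum fun i _ => mul_le_mul_of_nonneg_right i.2 (by positivity)
  suffices hxL : x ∈ L.topologicalClosure from
    (closure_minimal (s := (L : Set H)) (fun y hy => hL y hy) hclosed) hxL
  obtain ⟨p, hp, q, hq, hpq⟩ := L.topologicalClosure.exists_add_mem_mem_orthogonal x
  have hq0 : q ∈ (⨆ μ, eigenspace (C : H →ₗ[ℂ] H) μ)ᗮ := by
    rw [Submodule.mem_orthogonal]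
    intro u hu
    have : (⨆ μ, eigenspace (C : H →ₗ[ℂ] H) μ) ≤ (ℂ ∙ q)ᗮ := by
      refine iSup_le fun μ v hv => ?_
      rw [Submodule.mem_orthogonal_singleton_iff_inner_left]
      by_cases hv0 : v = 0
      · simp [hv0]
      by_cases hμ : μ.re ≤ c
      · exact hq v (L.le_topologicalClosure (Submodule.mem_iSup_of_mem ⟨μ, hμ⟩ hv))
      have hev : HasEigenvalue (C : H →ₗ[ℂ] H) μ :=
        hasEigenvalue_of_hasEigenvector ⟨hv, hv0⟩
      have hreal : ((μ.re : ℝ) : ℂ) = μ :=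
        Complex.conj_eq_iff_re.1 (hC.conj_eigenvalue_eq_self hev)
      have hvx : inner ℂ v x = 0 := hx μ.re (hS _ (not_le.1 hμ)) v (by rw [hreal]; exact hv)
      have hLv : L ≤ (ℂ ∙ v)ᗮ := by
        refine iSup_le fun ν w hw => ?_
        rw [Submodule.mem_orthogonal_singleton_iff_inner_right]
        have hne : μ ≠ ν := by
          rintro rfl
          exact hμ ν.2
        exact hC.orthogonalFamily_eigenspaces hne ⟨v, hv⟩ ⟨w, hw⟩
      have hvp : inner ℂ v p = 0 := by
        rw [← Submodule.mem_orthogonal_singleton_iff_inner_right]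
        exact L.topologicalClosure_minimal hLv (Submodule.isClosed_orthogonal _) hp
      rw [hpq, inner_add_right, hvp, zero_add] at hvx
      exact hvx
    exact (Submodule.mem_orthogonal_singleton_iff_inner_left).1 (this hu)
  rw [ContinuousLinearMap.orthogonalComplement_iSup_eigenspaces_eq_bot hc hC,
    Submodule.mem_bot] at hq0
  rw [hpq, hq0, add_zero]
  exact hp

open Module.End in
theorem cs_finite {H : Type*} [NormedAddCommGroup H] [InnerProductSpace ℂ H] [CompleteSpace H]
    (C : H →L[ℂ] H) (hc : IsCompactOperator C)
    (S : Set ℝ) (hS : ∀ μ ∈ S, 0 < μ) (hfin : eigCount C S ≠ ⊤) :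
    ∃ F : Finset S, eigCount C S = ((∑ μ ∈ F,
        Module.finrank ℂ (eigenspace (C : H →ₗ[ℂ] H) ((μ : ℝ) : ℂ)) : ℕ) : ℝ≥0∞) ∧
      ∀ μ : S, μ ∉ F → eigenspace (C : H →ₗ[ℂ] H) ((μ : ℝ) : ℂ) = ⊥ := by
  have h := ENNReal.finite_const_le_of_tsum_ne_top hfin one_ne_zero
  have hz : ∀ μ : S, μ ∉ h.toFinset →
      Module.finrank ℂ (eigenspace (C : H →ₗ[ℂ] H) ((μ : ℝ) : ℂ)) = 0 := by
    intro μ hμ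
    by_contra h0
    apply hμ
    rw [Set.Finite.mem_toFinset, Set.mem_ofPred_eq]
    exact_mod_cast Nat.one_le_iff_ne_zero.2 h0
  refine ⟨h.toFinset, ?_, ?_⟩
  · rw [eigCount, tsum_eq_sum (s := h.toFinset)]
    · push_cast; rfl
    · intro μ hμ
      rw [hz μ hμ, Nat.cast_zero]
  · intro μ hμ
    have : FiniteDimensional ℂ (eigenspace (C : H →ₗ[ℂ] H) ((μ : ℝ) : ℂ)) :=
      ContinuousLinearMap.finite_dimensional_eigenspace hc _
        (by exact_mod_cast (hS μ μ.2).ne')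
    exact Submodule.finrank_eq_zero.1 (hz μ hμ)

theorem cs_core {H₁ H₂ : Type*}
    [NormedAddCommGroup H₁] [InnerProductSpace ℂ H₁] [CompleteSpace H₁]
    [NormedAddCommGroup H₂] [InnerProductSpace ℂ H₂] [CompleteSpace H₂]
    (J : H₁ →L[ℂ] H₂) (T : H₂ →L[ℂ] H₂) (A B : H₁ →L[ℂ] H₁)
    (hTc : IsCompactOperator T) (hAc : IsCompactOperator A) (hBc : IsCompactOperator B)
    (hTs : (T : H₂ →ₗ[ℂ] H₂).IsSymmetric) (hAs : (A : H₁ →ₗ[ℂ] H₁).IsSymmetric)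
    (hBs : (B : H₁ →ₗ[ℂ] H₁).IsSymmetric)
    (s : ℝ) (hs : 0 < s) (ε : ℝ) (hε : ε ∈ Set.Ioo (0 : ℝ) 1)
    (hAform : ∀ x y, inner ℂ (A x) y = ((1 - ε : ℝ) : ℂ) * inner ℂ (J x) (J y))
    (hBform : ∀ x y, inner ℂ (B x) y = inner ℂ (J x) (J y) - inner ℂ (T (J x)) (J y))
    (F FB : Finset (Set.Ioi s)) (FT : Finset (Set.Ici ε))
    (hFB' : ∀ μ, μ ∉ FB → Module.End.eigenspace (B : H₁ →ₗ[ℂ] H₁) ((μ : ℝ) : ℂ) = ⊥)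
    (hFT' : ∀ μ, μ ∉ FT → Module.End.eigenspace (T : H₂ →ₗ[ℂ] H₂) ((μ : ℝ) : ℂ) = ⊥) :
    ∑ μ ∈ F, Module.finrank ℂ (Module.End.eigenspace (A : H₁ →ₗ[ℂ] H₁) ((μ : ℝ) : ℂ)) ≤
    ∑ μ ∈ FB, Module.finrank ℂ (Module.End.eigenspace (B : H₁ →ₗ[ℂ] H₁) ((μ : ℝ) : ℂ)) +
    ∑ μ ∈ FT, Module.finrank ℂ (Module.End.eigenspace (T : H₂ →ₗ[ℂ] H₂) ((μ : ℝ) : ℂ)) := by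
  classical
  let EA : F → Submodule ℂ H₁ := fun μ =>
    Module.End.eigenspace (A : H₁ →ₗ[ℂ] H₁) (((μ : Set.Ioi s) : ℝ) : ℂ)
  let EB : FB → Submodule ℂ H₁ := fun μ =>
    Module.End.eigenspace (B : H₁ →ₗ[ℂ] H₁) (((μ : Set.Ioi s) : ℝ) : ℂ)
  let ET : FT → Submodule ℂ H₂ := fun μ =>
    Module.End.eigenspace (T : H₂ →ₗ[ℂ] H₂) (((μ : Set.Ici ε) : ℝ) : ℂ)
  have iA : ∀ μ, FiniteDimensional ℂ (EA μ) := fun μ =>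
    ContinuousLinearMap.finite_dimensional_eigenspace hAc _
      (by exact_mod_cast (hs.trans μ.1.2).ne')
  have iB : ∀ μ, FiniteDimensional ℂ (EB μ) := fun μ =>
    ContinuousLinearMap.finite_dimensional_eigenspace hBc _
      (by exact_mod_cast (hs.trans μ.1.2).ne')
  have iT : ∀ μ, FiniteDimensional ℂ (ET μ) := fun μ =>
    ContinuousLinearMap.finite_dimensional_eigenspace hTc _
      (by exact_mod_cast (hε.1.trans_le μ.1.2).ne')
  let sf : (∀ μ, EA μ) →ₗ[ℂ] H₁ := ∑ μ, (EA μ).subtype ∘ₗ LinearMap.proj μ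
  have hsf : ∀ f, sf f = ∑ μ, (f μ : H₁) := fun f => by simp [sf]
  let Φ : (∀ μ, EA μ) →ₗ[ℂ] (∀ μ, EB μ) × (∀ μ, ET μ) :=
    LinearMap.prod
      (LinearMap.pi fun μ => ((EB μ).orthogonalProjectionOnto : H₁ →ₗ[ℂ] EB μ) ∘ₗ sf)
      (LinearMap.pi fun μ => ((ET μ).orthogonalProjectionOnto : H₂ →ₗ[ℂ] ET μ) ∘ₗ
        (J : H₁ →ₗ[ℂ] H₂) ∘ₗ sf)
  have hinj : Function.Injective Φ := by
    rw [injective_iff_map_eq_zero]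
    intro f hf
    by_contra hf0
    set x := sf f with hx
    have hxB : ∀ μ, (EB μ).orthogonalProjectionOnto x = 0 := fun μ =>
      congrFun (congrArg Prod.fst hf) μ
    have hxT : ∀ μ, (ET μ).orthogonalProjectionOnto (J x) = 0 := fun μ =>
      congrFun (congrArg Prod.snd hf) μ
    have h1 : (inner ℂ (B x) x).re ≤ s * ‖x‖ ^ 2 := by
      refine cs_upper B hBc hBs (Set.Ioi s) s (fun μ h => h) x fun μ hμ v hv => ?_
      by_cases hm : (⟨μ, hμ⟩ : Set.Ioi s) ∈ FB
      · have := hxB ⟨_, hm⟩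
        rw [Submodule.orthogonalProjectionOnto_eq_zero_iff] at this
        exact this v hv
      · rw [hFB' _ hm, Submodule.mem_bot] at hv
        simp [hv]
    have h2 : (inner ℂ (T (J x)) (J x)).re ≤ ε * ‖J x‖ ^ 2 := by
      refine cs_upper T hTc hTs (Set.Ici ε) ε (fun μ h => le_of_lt h) (J x) fun μ hμ v hv => ?_
      by_cases hm : (⟨μ, hμ⟩ : Set.Ici ε) ∈ FT
      · have := hxT ⟨_, hm⟩
        rw [Submodule.orthogonalProjectionOnto_eq_zero_iff] at this
        exact this v hv
      · rw [hFT' _ hm, Submodule.mem_bot] at hv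
        simp [hv]
    obtain ⟨h3, h4⟩ := cs_quad A hAs (fun μ : F => (((μ : Set.Ioi s) : ℝ) : ℂ))
      (Complex.ofReal_injective.comp (Subtype.val_injective.comp Subtype.val_injective))
      f Finset.univ
    have h5 : s * ‖x‖ ^ 2 < (inner ℂ (A x) x).re := by
      rw [hx, hsf, h3, h4, Finset.mul_sum]
      obtain ⟨μ, hμ⟩ := Function.ne_iff.1 hf0
      refine Finset.sum_lt_sum (fun i _ => ?_) ⟨μ, Finset.mem_univ _, ?_⟩
      · exact mul_le_mul_of_nonneg_right (le_of_lt i.1.2) (by positivity)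
      · have : 0 < ‖f μ‖ := norm_pos_iff.2 hμ
        exact mul_lt_mul_of_pos_right μ.1.2 (by positivity)
    have h6 : (inner ℂ (J x) (J x) : ℂ).re = ‖J x‖ ^ 2 := inner_self_eq_norm_sq (𝕜 := ℂ) (J x)
    rw [hAform, Complex.re_ofReal_mul, h6] at h5
    rw [hBform, Complex.sub_re, h6] at h1
    linarith
  have := LinearMap.finrank_le_finrank_of_injective hinj
  rw [Module.finrank_prod, Module.finrank_pi_fintype, Module.finrank_pi_fintype,
    Module.finrank_pi_fintype] at this
  rw [← Finset.sum_coe_sort F, ← Finset.sum_coe_sort FB, ← Finset.sum_coe_sort FT]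
  exact this

/-- `n₊(s; J*(I-T)J) ≥ n₊(s; (1-ε) J*J) - Tr 1_{[ε,∞)}(T)` for compact `J` and
compact self-adjoint `T`, `s > 0`, `ε ∈ (0,1)` (with truncated subtraction in `ℝ≥0∞`). -/
theorem counting_sandwich_lower_bound {H₁ H₂ : Type*}
    [NormedAddCommGroup H₁] [InnerProductSpace ℂ H₁] [CompleteSpace H₁]
    [NormedAddCommGroup H₂] [InnerProductSpace ℂ H₂] [CompleteSpace H₂]
    (J : H₁ →L[ℂ] H₂) (hJ : IsCompactOperator J)
    (T : H₂ →L[ℂ] H₂) (hTc : IsCompactOperator T) (hTsa : IsSelfAdjoint T)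
    (s : ℝ) (hs : 0 < s) (ε : ℝ) (hε : ε ∈ Set.Ioo (0 : ℝ) 1) :
    eigCount (((1 - ε : ℝ) : ℂ) • (ContinuousLinearMap.adjoint J ∘L J)) (Set.Ioi s)
        - eigCount T (Set.Ici ε)
      ≤ eigCount (ContinuousLinearMap.adjoint J ∘L ((1 - T) ∘L J)) (Set.Ioi s) := by
  classical
  rw [tsub_le_iff_right]
  have hAc : IsCompactOperator (((1 - ε : ℝ) : ℂ) • (ContinuousLinearMap.adjoint J ∘L J)) :=
    IsCompactOperator.smul (hJ.clm_comp (ContinuousLinearMap.adjoint J)) ((1 - ε : ℝ) : ℂ)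
  have hBc : IsCompactOperator (ContinuousLinearMap.adjoint J ∘L ((1 - T) ∘L J)) :=
    (hJ.clm_comp (1 - T : H₂ →L[ℂ] H₂)).clm_comp (ContinuousLinearMap.adjoint J)
  generalize hA : (((1 - ε : ℝ) : ℂ) • (ContinuousLinearMap.adjoint J ∘L J)) = A at hAc ⊢
  generalize hB : (ContinuousLinearMap.adjoint J ∘L ((1 - T) ∘L J)) = B at hBc ⊢
  have hTs : (T : H₂ →ₗ[ℂ] H₂).IsSymmetric := hTsa.isSymmetric
  have hAform : ∀ x y, inner ℂ (A x) y = ((1 - ε : ℝ) : ℂ) * inner ℂ (J x) (J y) := by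
    intro x y
    simp only [← hA, smul_apply, ContinuousLinearMap.comp_apply,
      inner_smul_left, ContinuousLinearMap.adjoint_inner_left, Complex.conj_ofReal]
  have hBform : ∀ x y, inner ℂ (B x) y = inner ℂ (J x) (J y) - inner ℂ (T (J x)) (J y) := by
    intro x y
    simp [← hB, ContinuousLinearMap.adjoint_inner_left]
  have hAs : (A : H₁ →ₗ[ℂ] H₁).IsSymmetric := by
    intro x y
    change inner ℂ (A x) y = inner ℂ x (A y)
    rw [← inner_conj_symm x (A y), hAform, hAform, map_mul, Complex.conj_ofReal, inner_conj_symm]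
  have hBs : (B : H₁ →ₗ[ℂ] H₁).IsSymmetric := by
    intro x y
    change inner ℂ (B x) y = inner ℂ x (B y)
    rw [← inner_conj_symm x (B y), hBform, hBform, map_sub, inner_conj_symm, inner_conj_symm]
    congr 1
    exact hTs (J x) (J y)
  by_cases hBfin : eigCount B (Set.Ioi s) = ⊤
  · simp [hBfin]
  by_cases hTfin : eigCount T (Set.Ici ε) = ⊤
  · simp [hTfin]
  obtain ⟨FB, hFB, hFB'⟩ := cs_finite B hBc (Set.Ioi s) (fun μ hμ => hs.trans hμ) hBfin
  obtain ⟨FT, hFT, hFT'⟩ := cs_finite T hTc (Set.Ici ε) (fun μ hμ => hε.1.trans_le hμ) hTfin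
  rw [hFB, hFT, eigCount, ENNReal.tsum_eq_iSup_sum]
  refine iSup_le fun F => ?_
  have := cs_core J T A B hTc hAc hBc hTs hAs hBs s hs ε hε hAform hBform F FB FT hFB' hFT'
  rw [← Nat.cast_sum, ← Nat.cast_add]
  exact Nat.cast_le.2 this
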